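/- arXiv:2110.03985 — 9 statements merged into one kernel-verified Lean document; each statement's English description precedes it below -/
import Mathlib

section
/- Let n ≥ 2 be an integer and let H > (n-1)/n be a real number. Then there exists a unique ρ > 0 such that sinh(ρ)^(n-1) = n·H·I_{n-1}(ρ). (This unique solution is the radius R_S of the rotationally invariant constant mean curvature sphere in H^n × R.) -/
/-- `I_m(t) = ∫₀^t sinh(τ)^m dτ`. -/
noncomputable def Ifun (m : ℕ) (t : ℝ) : ℝ := ∫ τ in (0:ℝ)..t, Real.sinh τ ^ m

open Set

theorem hasDerivAt_sinh_pow_sub_mul_Ifun (k : ℕ) (c t : ℝ) :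
    HasDerivAt (fun x => Real.sinh x ^ (k + 1) - c * Ifun (k + 1) x)
      (-(Real.sinh t ^ k * (c * Real.sinh t - (k + 1) * Real.cosh t))) t := by
  have hI : HasDerivAt (Ifun (k + 1)) (Real.sinh t ^ (k + 1)) t := by
    have hc : Continuous fun τ : ℝ => Real.sinh τ ^ (k + 1) := by fun_prop
    exact intervalIntegral.integral_hasDerivAt_right (hc.intervalIntegrable _ _)
      (hc.stronglyMeasurableAtFilter _ _) hc.continuousAt
  refine (((Real.hasDerivAt_sinh t).pow (k + 1)).sub (hI.const_mul c)).congr_deriv ?_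
  rw [Nat.add_sub_cancel]
  push_cast
  ring

theorem mul_sinh_sub_mul_cosh_eq (c m t : ℝ) :
    c * Real.sinh t - m * Real.cosh t = (c - m) * Real.sinh t - m * Real.exp (-t) := by
  rw [← Real.cosh_sub_sinh]
  ring

theorem strictMono_mul_sinh_sub_mul_cosh {c m : ℝ} (hm : 0 ≤ m) (hc : m < c) :
    StrictMono fun t => c * Real.sinh t - m * Real.cosh t := by
  intro x y hxy
  simp only [mul_sinh_sub_mul_cosh_eq]
  have h₁ := mul_lt_mul_of_pos_left (Real.sinh_lt_sinh.2 hxy) (sub_pos.2 hc)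
  have h₂ := mul_le_mul_of_nonneg_left (Real.exp_le_exp.2 (neg_le_neg hxy.le)) hm
  linarith

theorem sub_mul_sub_le_mul_sinh_sub_mul_cosh {c m t : ℝ} (hm : 0 ≤ m) (hc : m < c)
    (ht : 0 ≤ t) : (c - m) * t - m ≤ c * Real.sinh t - m * Real.cosh t := by
  rw [mul_sinh_sub_mul_cosh_eq]
  have h₁ := mul_le_mul_of_nonneg_left (Real.self_le_sinh_iff.2 ht) (sub_pos.2 hc).le
  have h₂ := mul_le_mul_of_nonneg_left (Real.exp_le_one_iff.2 (neg_nonpos.2 ht)) hm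
  linarith

theorem existsUnique_sinh_pow_eq_mul_Ifun (k : ℕ) (c : ℝ) (hc : (k : ℝ) + 1 < c) :
    ∃! ρ : ℝ, 0 < ρ ∧ Real.sinh ρ ^ (k + 1) = c * Ifun (k + 1) ρ := by
  have hm : (0 : ℝ) < k + 1 := by positivity
  set q : ℝ → ℝ := fun t => c * Real.sinh t - (k + 1) * Real.cosh t with hq
  set g : ℝ → ℝ := fun x => Real.sinh x ^ (k + 1) - c * Ifun (k + 1) x with hg
  have hd : ∀ t, HasDerivAt g (-(Real.sinh t ^ k * q t)) t :=
    hasDerivAt_sinh_pow_sub_mul_Ifun k c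
  have hgc : Continuous g := continuous_iff_continuousAt.2 fun t => (hd t).continuousAt
  have hqc : Continuous q := by fun_prop
  have hqm : StrictMono q := strictMono_mul_sinh_sub_mul_cosh hm.le hc
  have hg0 : g 0 = 0 := by simp [hg, Ifun]
  have hq0 : q 0 < 0 := by simp [hq]; linarith
  obtain ⟨T, hT1, hqT⟩ : ∃ T : ℝ, 1 ≤ T ∧ 1 ≤ q T := by
    have hcm : 0 < c - (k + 1) := sub_pos.2 hc
    have hdiv : 0 < (k + 2 : ℝ) / (c - (k + 1)) := by positivity
    refine ⟨1 + (k + 2) / (c - (k + 1)), by linarith, ?_⟩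
    refine le_trans ?_ (sub_mul_sub_le_mul_sinh_sub_mul_cosh hm.le hc (by linarith))
    rw [mul_add, mul_div_cancel₀ _ hcm.ne']
    linarith
  obtain ⟨t₀, ⟨ht₀, ht₀T⟩, hqt₀⟩ := intermediate_value_Icc (by linarith : (0 : ℝ) ≤ T)
    hqc.continuousOn (⟨hq0.le, by linarith⟩ : (0 : ℝ) ∈ Icc (q 0) (q T))
  have hinc : StrictMonoOn g (Icc 0 t₀) := by
    refine strictMonoOn_of_deriv_pos (convex_Icc _ _) hgc.continuousOn fun x hx => ?_
    rw [interior_Icc] at hx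
    rw [(hd x).deriv, neg_pos]
    exact mul_neg_of_pos_of_neg (pow_pos (Real.sinh_pos_iff.2 hx.1) _) (hqt₀ ▸ hqm hx.2)
  have hdec : StrictAntiOn g (Ici t₀) := by
    refine strictAntiOn_of_deriv_neg (convex_Ici _) hgc.continuousOn fun x hx => ?_
    rw [interior_Ici] at hx
    rw [(hd x).deriv, neg_lt_zero]
    exact mul_pos (pow_pos (Real.sinh_pos_iff.2 (ht₀.trans_lt hx)) _) (hqt₀ ▸ hqm hx)
  have hlin : AntitoneOn (fun x => g x + x) (Ici T) := by
    have hd' : ∀ x, HasDerivAt (fun x => g x + x) (-(Real.sinh x ^ k * q x) + 1) x :=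
      fun x => (hd x).add (hasDerivAt_id x)
    refine antitoneOn_of_deriv_nonpos (convex_Ici _) (by fun_prop)
      (fun x _ => (hd' x).differentiableAt.differentiableWithinAt) fun x hx => ?_
    rw [interior_Ici] at hx
    have hx1 : 1 ≤ x := hT1.trans (le_of_lt hx)
    have hs : 1 ≤ Real.sinh x ^ k :=
      one_le_pow₀ (hx1.trans (Real.self_le_sinh_iff.2 (by linarith)))
    rw [(hd' x).deriv]
    nlinarith [hqT.trans (hqm hx).le]
  have ht₀pos : 0 < t₀ := hqm.lt_iff_lt.1 (by rw [hqt₀]; exact hq0)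
  have hgt₀ : 0 < g t₀ := hg0 ▸ hinc ⟨le_rfl, ht₀⟩ ⟨ht₀, le_rfl⟩ ht₀pos
  obtain ⟨ρ, ⟨hρ, -⟩, hgρ⟩ : ∃ ρ ∈ Icc t₀ (T + |g T|), g ρ = 0 := by
    have hend : g (T + |g T|) ≤ 0 := by
      have h := hlin (mem_Ici.2 le_rfl) (mem_Ici.2 (le_add_of_nonneg_right (abs_nonneg (g T))))
        (le_add_of_nonneg_right (abs_nonneg (g T)))
      simp only at h
      linarith [le_abs_self (g T)]
    exact intermediate_value_Icc' (by linarith [abs_nonneg (g T)]) hgc.continuousOn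
      ⟨hend, hgt₀.le⟩
  refine ⟨ρ, ⟨ht₀pos.trans_le hρ, sub_eq_zero.1 hgρ⟩, fun y ⟨hy, hgy⟩ => ?_⟩
  have hgy : g y = 0 := sub_eq_zero.2 hgy
  have hyt : t₀ ≤ y := by
    by_contra! hlt
    have := hinc ⟨le_rfl, ht₀⟩ ⟨hy.le, hlt.le⟩ hy
    linarith
  exact hdec.injOn hyt hρ (hgy.trans hgρ.symm)

/-- For `n ≥ 2` and `H > (n-1)/n` there is a unique `ρ > 0` with
`sinh(ρ)^(n-1) = n·H·I_{n-1}(ρ)`. -/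
theorem statement1 (n : ℕ) (hn : 2 ≤ n) (H : ℝ) (hH : H > ((n : ℝ) - 1) / n) :
    ∃! ρ : ℝ, 0 < ρ ∧ Real.sinh ρ ^ (n - 1) = (n : ℝ) * H * Ifun (n - 1) ρ := by
  obtain ⟨k, rfl⟩ := Nat.exists_eq_add_of_le hn
  rw [show 2 + k - 1 = k + 1 by omega]
  refine existsUnique_sinh_pow_eq_mul_Ifun k _ ?_
  rw [gt_iff_lt, div_lt_iff₀ (by positivity)] at hH
  push_cast at hH ⊢
  linarith
end

section
/- Let n ≥ 2 be an integer, let H > (n-1)/n be a real number, and let R_S > 0 be the unique positive solution of sinh(ρ)^(n-1) = n·H·I_{n-1}(ρ). Then artanh((n-1)/(nH)) < R_S. -/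
/-- Inverse hyperbolic tangent: `artanh x = (1/2)·log((1+x)/(1-x))`. -/
noncomputable def artanh (x : ℝ) : ℝ := (1 / 2) * Real.log ((1 + x) / (1 - x))

/-- The primitive of `sinh ^ m` lies strictly below `sinh ^ (m + 1) / (m * cosh)` on `(0, ∞)`. -/
theorem mul_Ifun_mul_cosh_lt (m : ℕ) {t : ℝ} (ht : 0 < t) :
    (m : ℝ) * Ifun m t * Real.cosh t < Real.sinh t ^ (m + 1) := by
  have hI (x : ℝ) : HasDerivAt (Ifun m) (Real.sinh x ^ m) x :=
    intervalIntegral.integral_hasDerivAt_right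
      ((Real.continuous_sinh.pow m).intervalIntegrable _ _)
      ((Real.continuous_sinh.pow m).stronglyMeasurableAtFilter _ _)
      (Real.continuous_sinh.pow m).continuousAt
  have hd (x : ℝ) : HasDerivAt (fun x => Real.sinh x ^ (m + 1) / Real.cosh x - m * Ifun m x)
      (Real.sinh x ^ m / Real.cosh x ^ 2) x := by
    have hc : Real.cosh x ≠ 0 := (Real.cosh_pos x).ne'
    refine ((((Real.hasDerivAt_sinh x).fun_pow (m + 1)).fun_div
      (Real.hasDerivAt_cosh x) hc).sub ((hI x).const_mul (m : ℝ))).congr_deriv ?_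
    field_simp
    rw [Real.cosh_sq]
    push_cast
    ring
  have hmono : StrictMonoOn
      (fun x => Real.sinh x ^ (m + 1) / Real.cosh x - m * Ifun m x) (Set.Ici 0) := by
    refine strictMonoOn_of_deriv_pos (convex_Ici 0)
      (fun x _ => (hd x).continuousAt.continuousWithinAt) fun x hx => ?_
    rw [interior_Ici, Set.mem_Ioi] at hx
    rw [(hd x).deriv]
    exact div_pos (pow_pos (Real.sinh_pos_iff.2 hx) m) (pow_pos (Real.cosh_pos x) 2)
  have h := hmono Set.self_mem_Ici ht.le ht
  simp only [Ifun, intervalIntegral.integral_same, Real.sinh_zero, ne_eq, Nat.add_eq_zero_iff,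
    one_ne_zero, and_false, not_false_eq_true, zero_pow, zero_div, mul_zero, sub_zero] at h
  exact (lt_div_iff₀ (Real.cosh_pos t)).1 (sub_pos.1 h)

/-- For `n ≥ 2`, `H > (n-1)/n`, if `R_S > 0` is the unique positive solution of
`sinh(ρ)^(n-1) = n·H·I_{n-1}(ρ)`, then `artanh((n-1)/(nH)) < R_S`. -/
theorem statement3 (n : ℕ) (hn : 2 ≤ n) (H : ℝ) (hH : H > ((n : ℝ) - 1) / n)
    (RS : ℝ) (hRS : 0 < RS)
    (heq : Real.sinh RS ^ (n - 1) = (n : ℝ) * H * Ifun (n - 1) RS)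
    (huniq : ∀ ρ : ℝ, 0 < ρ →
      Real.sinh ρ ^ (n - 1) = (n : ℝ) * H * Ifun (n - 1) ρ → ρ = RS) :
    artanh (((n : ℝ) - 1) / ((n : ℝ) * H)) < RS := by
  have hn0 : (0 : ℝ) < n := by positivity
  have hm : ((n - 1 : ℕ) : ℝ) = (n : ℝ) - 1 := by
    rw [Nat.cast_sub (by omega), Nat.cast_one]
  have hm0 : (0 : ℝ) ≤ (n : ℝ) - 1 := hm ▸ Nat.cast_nonneg _
  have hnH : 0 < (n : ℝ) * H := mul_pos hn0 ((div_nonneg hm0 hn0.le).trans_lt hH)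
  have hs : 0 < Real.sinh RS := Real.sinh_pos_iff.2 hRS
  have hI : 0 < Ifun (n - 1) RS :=
    pos_of_mul_pos_right (heq ▸ pow_pos hs (n - 1)) hnH.le
  have hlt := mul_Ifun_mul_cosh_lt (n - 1) hRS
  rw [pow_succ, heq, hm] at hlt
  have hx : ((n : ℝ) - 1) / ((n : ℝ) * H) < Real.tanh RS := by
    rw [Real.tanh_eq_sinh_div_cosh, div_lt_div_iff₀ hnH (Real.cosh_pos RS)]
    refine lt_of_mul_lt_mul_left ?_ hI.le
    linarith
  have hx0 : 0 ≤ ((n : ℝ) - 1) / ((n : ℝ) * H) := div_nonneg hm0 hnH.le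
  have ht1 : Real.tanh RS < 1 := Real.tanh_lt_one RS
  calc artanh (((n : ℝ) - 1) / ((n : ℝ) * H))
      = Real.artanh (((n : ℝ) - 1) / ((n : ℝ) * H)) :=
        (Real.artanh_eq_half_log ⟨by linarith, (hx.trans ht1).le⟩).symm
    _ < Real.artanh (Real.tanh RS) := Real.artanh_lt_artanh (by linarith) ht1 hx
    _ = RS := Real.artanh_tanh RS
end

section
/- Let n ≥ 2 be an integer and let H > (n-1)/n be a real number. Define ψ(x) = cosh(x)^(n-1) − n·H·J_{n-1}(x). Then ψ is strictly decreasing on [0, ∞) and there exists a unique ρ > 0 with ψ(ρ) = 0. (This unique solution is the radius R_C of the horizontal constant mean curvature cylinder in H^n × R.) -/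
/-- `J_m(t) = ∫₀^t cosh(τ)^m dτ`. -/
noncomputable def Jfun (m : ℕ) (t : ℝ) : ℝ := ∫ τ in (0:ℝ)..t, Real.cosh τ ^ m

theorem Jfun_hasDerivAt (m : ℕ) (x : ℝ) : HasDerivAt (Jfun m) (Real.cosh x ^ m) x := by
  have hc : Continuous fun τ : ℝ => Real.cosh τ ^ m := Real.continuous_cosh.pow m
  exact hc.integral_hasStrictDerivAt 0 x |>.hasDerivAt

theorem cosh_pow_sub_mul_Jfun_hasDerivAt (m : ℕ) (c x : ℝ) :
    HasDerivAt (fun x : ℝ => Real.cosh x ^ m - c * Jfun m x)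
      (m * Real.cosh x ^ (m - 1) * Real.sinh x - c * Real.cosh x ^ m) x :=
  ((Real.hasDerivAt_cosh x).pow m).sub ((Jfun_hasDerivAt m x).const_mul c)

theorem cosh_pow_sub_mul_Jfun_deriv_le {m : ℕ} {c : ℝ} (hc : m < c) (x : ℝ) :
    m * Real.cosh x ^ (m - 1) * Real.sinh x - c * Real.cosh x ^ m ≤ -(c - m) := by
  have h1 : (m : ℝ) * Real.cosh x ^ (m - 1) * Real.sinh x ≤ m * Real.cosh x ^ m := by
    rcases m with _ | k
    · simp
    · rw [Nat.add_sub_cancel, pow_succ, mul_assoc]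
      have := (Real.sinh_lt_cosh x).le
      have := Real.cosh_pos x
      gcongr
  have h2 : 1 ≤ Real.cosh x ^ m := one_le_pow₀ (Real.one_le_cosh x)
  nlinarith

theorem cosh_pow_sub_mul_Jfun_strictAnti {m : ℕ} {c : ℝ} (hc : m < c) :
    StrictAnti (fun x : ℝ => Real.cosh x ^ m - c * Jfun m x) := by
  refine strictAnti_of_deriv_neg fun x => ?_
  rw [(cosh_pow_sub_mul_Jfun_hasDerivAt m c x).deriv]
  linarith [cosh_pow_sub_mul_Jfun_deriv_le hc x]

theorem cosh_pow_sub_mul_Jfun_zero (m : ℕ) (c : ℝ) :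
    Real.cosh 0 ^ m - c * Jfun m 0 = 1 := by
  simp [Jfun]

theorem cosh_pow_sub_mul_Jfun_le {m : ℕ} {c : ℝ} (hc : m < c) {x : ℝ} (hx : 0 ≤ x) :
    Real.cosh x ^ m - c * Jfun m x ≤ 1 - (c - m) * x := by
  have h : Antitone fun x : ℝ => Real.cosh x ^ m - c * Jfun m x + (c - m) * x := by
    have hd (x : ℝ) :=
      (cosh_pow_sub_mul_Jfun_hasDerivAt m c x).add ((hasDerivAt_id' x).const_mul (c - m))
    refine antitone_of_deriv_nonpos (fun x => (hd x).differentiableAt) fun x => ?_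
    refine (hd x).deriv.trans_le ?_
    linarith [cosh_pow_sub_mul_Jfun_deriv_le hc x]
  have := h hx
  simp only [cosh_pow_sub_mul_Jfun_zero, mul_zero, add_zero] at this
  linarith

/-- For `n ≥ 2`, `H > (n-1)/n`, the function `ψ(x) = cosh(x)^(n-1) − n·H·J_{n-1}(x)` is
strictly decreasing on `[0, ∞)` and there is a unique `ρ > 0` with `ψ(ρ) = 0`. -/
theorem statement4 (n : ℕ) (hn : 2 ≤ n) (H : ℝ) (hH : H > ((n : ℝ) - 1) / n) :
    StrictAntiOn (fun x : ℝ => Real.cosh x ^ (n - 1) - (n : ℝ) * H * Jfun (n - 1) x)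
        (Set.Ici 0) ∧
    ∃! ρ : ℝ, 0 < ρ ∧
      Real.cosh ρ ^ (n - 1) - (n : ℝ) * H * Jfun (n - 1) ρ = 0 := by
  have hc : ((n - 1 : ℕ) : ℝ) < n * H := by
    rw [Nat.cast_sub (by omega), Nat.cast_one]
    rwa [gt_iff_lt, div_lt_iff₀' (by positivity)] at hH
  have hanti := cosh_pow_sub_mul_Jfun_strictAnti hc
  refine ⟨hanti.strictAntiOn _, ?_⟩
  have hgap : 0 < (n : ℝ) * H - (n - 1 : ℕ) := sub_pos.2 hc
  have hb : 0 ≤ ((n : ℝ) * H - (n - 1 : ℕ))⁻¹ := (inv_pos.2 hgap).le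
  have hcont : Continuous fun x : ℝ => Real.cosh x ^ (n - 1) - (n : ℝ) * H * Jfun (n - 1) x :=
    continuous_iff_continuousAt.2 fun x =>
      (cosh_pow_sub_mul_Jfun_hasDerivAt (n - 1) (n * H) x).continuousAt
  have hneg := cosh_pow_sub_mul_Jfun_le hc hb
  rw [mul_inv_cancel₀ hgap.ne', sub_self] at hneg
  have hzero := cosh_pow_sub_mul_Jfun_zero (n - 1) (n * H)
  obtain ⟨ρ, hρ, hρ0⟩ :=
    intermediate_value_Icc' hb hcont.continuousOn ⟨hneg, hzero.symm ▸ zero_le_one⟩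
  refine ⟨ρ, ⟨hρ.1.lt_of_ne ?_, hρ0⟩, fun y hy => hanti.injective (hy.2.trans hρ0.symm)⟩
  rintro rfl
  exact one_ne_zero (hzero.symm.trans hρ0)
end

section
/- Let n ≥ 2 be an integer and let H > (n-1)/n be a real number. Let R_S > 0 be the unique positive solution of sinh(ρ)^(n-1) = n·H·I_{n-1}(ρ), and let R_C > 0 be the unique positive solution of cosh(ρ)^(n-1) = n·H·J_{n-1}(ρ). Then R_S > R_C. -/
/-- For `t > 0`, `∫₀^t (cosh τ / cosh t)^m dτ > ∫₀^t (sinh τ / sinh t)^m dτ`, in cleared form. -/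
lemma Ifun_mul_cosh_pow_lt_Jfun_mul_sinh_pow {m : ℕ} (hm : m ≠ 0) {t : ℝ} (ht : 0 < t) :
    Ifun m t * Real.cosh t ^ m < Jfun m t * Real.sinh t ^ m := by
  unfold Ifun Jfun
  rw [← intervalIntegral.integral_mul_const, ← intervalIntegral.integral_mul_const]
  have key : ∀ τ : ℝ, τ < t → Real.sinh τ * Real.cosh t < Real.cosh τ * Real.sinh t := by
    intro τ hτ
    have h : 0 < Real.sinh (t - τ) := Real.sinh_pos_iff.2 (sub_pos.2 hτ)
    rw [Real.sinh_sub] at h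
    linarith
  refine intervalIntegral.integral_lt_integral_of_continuousOn_of_le_of_exists_lt ht
    (by fun_prop) (by fun_prop) (fun τ hτ => ?_) ⟨0, ⟨le_rfl, ht.le⟩, ?_⟩
  · rw [← mul_pow, ← mul_pow]
    refine pow_le_pow_left₀
      (mul_nonneg (Real.sinh_nonneg_iff.2 hτ.1.le) (Real.cosh_pos t).le) ?_ m
    rcases hτ.2.eq_or_lt with rfl | h
    · exact (mul_comm _ _).le
    · exact (key τ h).le
  · rw [← mul_pow, ← mul_pow]
    exact pow_lt_pow_left₀ (key 0 ht) (by simp) hm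

lemma continuous_Jfun (m : ℕ) : Continuous (Jfun m) :=
  intervalIntegral.continuous_primitive
    (fun a b => (Real.continuous_cosh.pow m).intervalIntegrable a b) 0

/-- For `n ≥ 2`, `H > (n-1)/n`, if `R_S > 0` is the unique positive solution of
`sinh(ρ)^(n-1) = n·H·I_{n-1}(ρ)` and `R_C > 0` is the unique positive solution of
`cosh(ρ)^(n-1) = n·H·J_{n-1}(ρ)`, then `R_S > R_C`. -/
theorem statement5 (n : ℕ) (hn : 2 ≤ n) (H : ℝ) (hH : H > ((n : ℝ) - 1) / n)
    (RS : ℝ) (hRS : 0 < RS)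
    (heqS : Real.sinh RS ^ (n - 1) = (n : ℝ) * H * Ifun (n - 1) RS)
    (huniqS : ∀ ρ : ℝ, 0 < ρ →
      Real.sinh ρ ^ (n - 1) = (n : ℝ) * H * Ifun (n - 1) ρ → ρ = RS)
    (RC : ℝ) (hRC : 0 < RC)
    (heqC : Real.cosh RC ^ (n - 1) = (n : ℝ) * H * Jfun (n - 1) RC)
    (huniqC : ∀ ρ : ℝ, 0 < ρ →
      Real.cosh ρ ^ (n - 1) = (n : ℝ) * H * Jfun (n - 1) ρ → ρ = RC) :
    RS > RC := by
  have hn0 : (0 : ℝ) < n := by positivity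
  have hn1 : (1 : ℝ) ≤ n := by exact_mod_cast (by omega : 1 ≤ n)
  have hH0 : 0 < H := lt_of_le_of_lt (div_nonneg (sub_nonneg.2 hn1) hn0.le) hH
  have hs : 0 < Real.sinh RS ^ (n - 1) := pow_pos (Real.sinh_pos_iff.2 hRS) _
  have hlt : Real.cosh RS ^ (n - 1) < n * H * Jfun (n - 1) RS := by
    have h := mul_lt_mul_of_pos_left
      (Ifun_mul_cosh_pow_lt_Jfun_mul_sinh_pow (by omega : n - 1 ≠ 0) hRS) (mul_pos hn0 hH0)
    rw [← mul_assoc, ← heqS, ← mul_assoc, mul_comm] at h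
    exact lt_of_mul_lt_mul_right h hs.le
  have hcont : ContinuousOn
      (fun ρ => Real.cosh ρ ^ (n - 1) - n * H * Jfun (n - 1) ρ) (Set.Icc 0 RS) :=
    ((Real.continuous_cosh.pow _).sub
      (continuous_const.mul (continuous_Jfun _))).continuousOn
  obtain ⟨ρ, ⟨hρ0, hρS⟩, hρ⟩ := intermediate_value_Ioo' hRS.le hcont
    (show (0 : ℝ) ∈ Set.Ioo _ _ from ⟨sub_neg.2 hlt, by simp [Jfun]⟩)
  exact huniqC ρ hρ0 (sub_eq_zero.1 hρ) ▸ hρS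
end

section
/- Let n ≥ 3 be an integer and let H > (n-1)/n be a real number, and set x̃ = artanh((n-1)/(nH)). Then cosh(x̃)^(n-1) < n·H·J_{n-1}(x̃). -/
theorem Jfun_pos (m : ℕ) {t : ℝ} (ht : 0 < t) : 0 < Jfun m t :=
  intervalIntegral.intervalIntegral_pos_of_pos
    ((Real.continuous_cosh.pow m).intervalIntegrable _ _)
    (fun _ => pow_pos (Real.cosh_pos _) m) ht

/-- The reduction formula for the integrals of powers of `cosh`. -/
theorem Jfun_add_two (k : ℕ) (t : ℝ) :
    ((k : ℝ) + 2) * Jfun (k + 2) t =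
      Real.sinh t * Real.cosh t ^ (k + 1) + ((k : ℝ) + 1) * Jfun k t := by
  have hderiv : ∀ x ∈ Set.uIcc 0 t,
      HasDerivAt (fun y => Real.sinh y * Real.cosh y ^ (k + 1))
        (((k : ℝ) + 2) * Real.cosh x ^ (k + 2) - ((k : ℝ) + 1) * Real.cosh x ^ k) x := by
    intro x _
    refine ((Real.hasDerivAt_sinh x).mul
      ((Real.hasDerivAt_cosh x).pow (k + 1))).congr_deriv ?_
    simp only [Nat.add_sub_cancel, Pi.pow_apply]
    push_cast
    linear_combination (-((k : ℝ) + 1) * Real.cosh x ^ k) * Real.cosh_sq x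
  have hint := intervalIntegral.integral_eq_sub_of_hasDerivAt hderiv
    (Continuous.intervalIntegrable (by fun_prop) _ _)
  rw [intervalIntegral.integral_sub (Continuous.intervalIntegrable (by fun_prop) _ _)
    (Continuous.intervalIntegrable (by fun_prop) _ _), intervalIntegral.integral_const_mul,
    intervalIntegral.integral_const_mul, Real.sinh_zero, zero_mul, sub_zero] at hint
  unfold Jfun
  linarith

theorem artanh_eq_real_artanh {x : ℝ} (hx : x ∈ Set.Icc (-1) 1) : artanh x = Real.artanh x :=
  (Real.artanh_eq_half_log hx).symm

/-- For `n ≥ 3` and `H > (n-1)/n`, with `x̃ = artanh((n-1)/(nH))`, one has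
`cosh(x̃)^(n-1) < n·H·J_{n-1}(x̃)`. -/
theorem statement7 (n : ℕ) (hn : 3 ≤ n) (H : ℝ) (hH : H > ((n : ℝ) - 1) / n) :
    Real.cosh (artanh (((n : ℝ) - 1) / ((n : ℝ) * H))) ^ (n - 1) <
      (n : ℝ) * H * Jfun (n - 1) (artanh (((n : ℝ) - 1) / ((n : ℝ) * H))) := by
  obtain ⟨k, rfl⟩ : ∃ k, n = k + 3 := ⟨n - 3, by omega⟩
  have hk : (0 : ℝ) ≤ k := k.cast_nonneg
  have hsub : k + 3 - 1 = k + 2 := rfl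
  rw [hsub]
  push_cast at hH ⊢
  have hlt : (k : ℝ) + 3 - 1 < ((k : ℝ) + 3) * H := by
    rwa [gt_iff_lt, div_lt_iff₀' (by positivity)] at hH
  have hnH : 0 < ((k : ℝ) + 3) * H := by linarith
  set y : ℝ := ((k : ℝ) + 3 - 1) / (((k : ℝ) + 3) * H) with hy
  have hy0 : 0 < y := div_pos (by linarith) hnH
  have hy1 : y < 1 := (div_lt_one hnH).2 hlt
  rw [artanh_eq_real_artanh ⟨by linarith, hy1.le⟩]
  have ht : 0 < Real.artanh y := Real.artanh_pos ⟨hy0, hy1⟩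
  have htanh := Real.tanh_artanh (x := y) ⟨by linarith, hy1⟩
  set t := Real.artanh y
  have hsinh : Real.sinh t = y * Real.cosh t := by
    rw [← htanh, Real.tanh_eq_sinh_div_cosh, div_mul_cancel₀ _ (Real.cosh_pos t).ne']
  have hmul : ((k : ℝ) + 3) * H * y = (k : ℝ) + 2 := by
    rw [hy, mul_div_cancel₀ _ hnH.ne']
    ring
  refine lt_of_mul_lt_mul_left ?_ hy0.le
  calc y * Real.cosh t ^ (k + 2)
      = Real.sinh t * Real.cosh t ^ (k + 1) := by rw [hsinh]; ring
    _ < ((k : ℝ) + 2) * Jfun (k + 2) t := by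
      rw [Jfun_add_two]
      exact lt_add_of_pos_right _ (mul_pos (by positivity) (Jfun_pos k ht))
    _ = y * (((k : ℝ) + 3) * H * Jfun (k + 2) t) := by rw [← hmul]; ring
end

section
/- For every ρ ≥ 0, one has ∫₀^ρ (cosh(t) − 1)/√(sinh(t)² − (cosh(t) − 1)²) dt = 2·(cosh(ρ/2) − 1). (This is the explicit formula λ_{1/2,0}(ρ) = 2(cosh(ρ/2) − 1) for the generating curve of the rotationally invariant entire graph of constant mean curvature 1/2 in H² × R.) -/
/-- On the nonnegative axis the half-angle formulas reduce the quotient to `sinh (t / 2)`. -/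
theorem cosh_sub_one_div_sqrt_eq_sinh_half {t : ℝ} (ht : 0 ≤ t) :
    (Real.cosh t - 1) / Real.sqrt (Real.sinh t ^ 2 - (Real.cosh t - 1) ^ 2)
      = Real.sinh (t / 2) := by
  have hs : 0 ≤ Real.sinh (t / 2) := Real.sinh_nonneg_iff.2 (by linarith)
  have hcosh : Real.cosh t = 1 + 2 * Real.sinh (t / 2) ^ 2 := by
    have h := Real.cosh_two_mul (t / 2)
    rw [mul_div_cancel₀ t two_ne_zero, Real.cosh_sq] at h
    linarith
  have hroot : Real.sinh t ^ 2 - (Real.cosh t - 1) ^ 2 = (2 * Real.sinh (t / 2)) ^ 2 := by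
    rw [Real.sinh_sq, hcosh]
    ring
  rw [hroot, Real.sqrt_sq (by positivity), hcosh]
  rcases hs.eq_or_lt with h | h
  · simp [← h]
  · field_simp
    ring

/-- For every `ρ ≥ 0`,
`∫₀^ρ (cosh t − 1)/√(sinh² t − (cosh t − 1)²) dt = 2(cosh(ρ/2) − 1)`. -/
theorem statement8 (ρ : ℝ) (hρ : 0 ≤ ρ) :
    ∫ t in (0:ℝ)..ρ,
        (Real.cosh t - 1) / Real.sqrt (Real.sinh t ^ 2 - (Real.cosh t - 1) ^ 2)
      = 2 * (Real.cosh (ρ / 2) - 1) := by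
  have hcongr : ∫ t in (0:ℝ)..ρ,
        (Real.cosh t - 1) / Real.sqrt (Real.sinh t ^ 2 - (Real.cosh t - 1) ^ 2)
      = ∫ t in (0:ℝ)..ρ, Real.sinh (t / 2) := by
    refine intervalIntegral.integral_congr fun t ht => ?_
    rw [Set.uIcc_of_le hρ] at ht
    exact cosh_sub_one_div_sqrt_eq_sinh_half ht.1
  have hderiv : ∀ t ∈ Set.uIcc 0 ρ,
      HasDerivAt (fun t => 2 * Real.cosh (t / 2)) (Real.sinh (t / 2)) t := fun t _ => by
    have h := (((hasDerivAt_id' t).div_const 2).cosh).const_mul 2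
    rwa [show 2 * (Real.sinh (t / 2) * (1 / 2)) = Real.sinh (t / 2) by ring] at h
  have hcont : Continuous fun t : ℝ => Real.sinh (t / 2) := by fun_prop
  rw [hcongr, intervalIntegral.integral_eq_sub_of_hasDerivAt hderiv
    (hcont.intervalIntegrable 0 ρ), zero_div, Real.cosh_zero]
  ring
end

section
/- Let H > 1/2 be a real number. For every ρ with 0 ≤ ρ < arcosh((4H²+1)/(4H²−1)), one has ∫₀^ρ 2H·(cosh(t) − 1)/√(sinh(t)² − 4H²·(cosh(t) − 1)²) dt = (4H/√(4H²−1))·arcsin(1/(2H)) − (4H/√(4H²−1))·arctan(√((1 − 4H²·tanh(ρ/2)²)/(4H²−1))). -/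
/-- Inverse hyperbolic cosine: `arcosh x = log (x + √(x² − 1))`. -/
noncomputable def arcosh (x : ℝ) : ℝ := Real.log (x + Real.sqrt (x ^ 2 - 1))

open Real in
/-- On the domain of the generating curve the half-angle expression is positive. -/
theorem one_sub_mul_tanh_half_sq_pos {H t : ℝ} (hH : 1 / 2 < H) (ht : 0 ≤ t)
    (h : t < _root_.arcosh ((4 * H ^ 2 + 1) / (4 * H ^ 2 - 1))) :
    0 < 1 - 4 * H ^ 2 * tanh (t / 2) ^ 2 := by
  have hk : 0 < 4 * H ^ 2 - 1 := by nlinarith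
  have hx : 1 ≤ (4 * H ^ 2 + 1) / (4 * H ^ 2 - 1) := by
    rw [le_div_iff₀ hk]; linarith
  have hc : cosh t < (4 * H ^ 2 + 1) / (4 * H ^ 2 - 1) := by
    rw [← cosh_arcosh hx, cosh_lt_cosh, abs_of_nonneg ht]
    exact h.trans_le (le_abs_self _)
  rw [lt_div_iff₀ hk] at hc
  have h2 : cosh t = cosh (t / 2) ^ 2 + sinh (t / 2) ^ 2 := by
    rw [← cosh_two_mul]; ring_nf
  have hs := cosh_sq (t / 2)
  have hp := cosh_pos (t / 2)
  rw [tanh_eq_sinh_div_cosh, div_pow, sub_pos, ← mul_div_assoc, div_lt_one (by positivity)]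
  rw [h2, hs] at hc
  linarith

open Real in
/-- Half-angle form of the slope of the generating curve. -/
theorem slope_eq_tanh_half {H t : ℝ} (ht : 0 ≤ t) :
    2 * H * (cosh t - 1) / √(sinh t ^ 2 - 4 * H ^ 2 * (cosh t - 1) ^ 2) =
      2 * H * tanh (t / 2) / √(1 - 4 * H ^ 2 * tanh (t / 2) ^ 2) := by
  obtain rfl | ht := ht.eq_or_lt
  · simp
  have hc := cosh_pos (t / 2)
  have hs : 0 < sinh (t / 2) := sinh_pos_iff.2 (by linarith)
  have h1 : cosh t - 1 = 2 * sinh (t / 2) ^ 2 := by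
    have h := cosh_two_mul (t / 2)
    rw [cosh_sq, mul_div_cancel₀ _ two_ne_zero] at h
    linarith
  have h2 : sinh t = 2 * sinh (t / 2) * cosh (t / 2) := by
    rw [← sinh_two_mul]; ring_nf
  have h3 : sinh t ^ 2 - 4 * H ^ 2 * (cosh t - 1) ^ 2 =
      (2 * sinh (t / 2) * cosh (t / 2)) ^ 2 * (1 - 4 * H ^ 2 * tanh (t / 2) ^ 2) := by
    rw [h1, h2, tanh_eq_sinh_div_cosh]
    field_simp
  rw [h3, sqrt_mul (sq_nonneg _), sqrt_sq (by positivity), h1, ← div_div]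
  congr 1
  rw [tanh_eq_sinh_div_cosh]
  field_simp

open Real in
/-- Antiderivative of the half-angle form of the slope. -/
theorem hasDerivAt_neg_mul_arctan {H t : ℝ} (hH : 1 / 2 < H)
    (h : 0 < 1 - 4 * H ^ 2 * tanh (t / 2) ^ 2) :
    HasDerivAt (fun t => -(4 * H / √(4 * H ^ 2 - 1) *
        arctan √((1 - 4 * H ^ 2 * tanh (t / 2) ^ 2) / (4 * H ^ 2 - 1))))
      (2 * H * tanh (t / 2) / √(1 - 4 * H ^ 2 * tanh (t / 2) ^ 2)) t := by
  have hk : 0 < 4 * H ^ 2 - 1 := by nlinarith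
  have hT : HasDerivAt (fun t => tanh (t / 2)) ((1 - tanh (t / 2) ^ 2) / 2) t := by
    have hc := cosh_pos (t / 2)
    have hd := (hasDerivAt_id t).div_const 2
    have := hd.sinh.div hd.cosh hc.ne'
    refine (this.congr_deriv ?_).congr_of_eventuallyEq (.of_forall fun x => ?_)
    · rw [tanh_eq_sinh_div_cosh]
      simp only [id]
      field_simp
    · simp [tanh_eq_sinh_div_cosh]
  have hu := ((((hT.pow 2).const_mul (4 * H ^ 2)).const_sub 1).div_const (4 * H ^ 2 - 1)).sqrt
    (div_pos h hk).ne'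
  refine ((hu.arctan.const_mul (4 * H / √(4 * H ^ 2 - 1))).neg).congr_deriv ?_
  simp only [Pi.pow_apply]
  have hq : 0 < 1 - tanh (t / 2) ^ 2 := by nlinarith [sq_nonneg (tanh (t / 2))]
  have hone : 1 + (1 - 4 * H ^ 2 * tanh (t / 2) ^ 2) / (4 * H ^ 2 - 1) =
      4 * H ^ 2 * (1 - tanh (t / 2) ^ 2) / (4 * H ^ 2 - 1) := by
    field_simp
    ring
  rw [sq_sqrt (div_pos h hk).le, hone, sqrt_div h.le]
  have ha := sqrt_pos.2 h
  have hb := sqrt_pos.2 hk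
  have hH0 : 0 < H := by linarith
  generalize √(1 - 4 * H ^ 2 * tanh (t / 2) ^ 2) = a at *
  generalize √(4 * H ^ 2 - 1) = b at *
  generalize tanh (t / 2) = T at *
  field_simp
  ring

open Real in
theorem arctan_inv_sqrt_eq_arcsin {x : ℝ} (hx : 1 < x) :
    arctan √(1 / (x ^ 2 - 1)) = arcsin (1 / x) := by
  have hk : 0 < x ^ 2 - 1 := by nlinarith
  have hx0 : 0 < x := by linarith
  have h : 1 + 1 / (x ^ 2 - 1) = x ^ 2 / (x ^ 2 - 1) := by
    field_simp
    ring
  have hb := sqrt_pos.2 hk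
  rw [arctan_eq_arcsin, sq_sqrt (by positivity), h, sqrt_div (by positivity),
    sqrt_div (by positivity), sqrt_sq hx0.le, sqrt_one]
  congr 1
  field_simp

/-- For `H > 1/2` and `0 ≤ ρ < arcosh((4H²+1)/(4H²−1))`, the explicit formula for the
generating curve `λ_{H,0}` of the rotationally invariant CMC `H` sphere in `H²×R`. -/
theorem statement9 (H : ℝ) (hH : H > 1 / 2) (ρ : ℝ) (h0 : 0 ≤ ρ)
    (h1 : ρ < arcosh ((4 * H ^ 2 + 1) / (4 * H ^ 2 - 1))) :
    ∫ t in (0:ℝ)..ρ,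
        2 * H * (Real.cosh t - 1) /
          Real.sqrt (Real.sinh t ^ 2 - 4 * H ^ 2 * (Real.cosh t - 1) ^ 2)
      = (4 * H / Real.sqrt (4 * H ^ 2 - 1)) * Real.arcsin (1 / (2 * H)) -
        (4 * H / Real.sqrt (4 * H ^ 2 - 1)) *
          Real.arctan (Real.sqrt ((1 - 4 * H ^ 2 * Real.tanh (ρ / 2) ^ 2) / (4 * H ^ 2 - 1))) := by
  have hpos : ∀ t ∈ Set.uIcc 0 ρ, 0 < 1 - 4 * H ^ 2 * Real.tanh (t / 2) ^ 2 := by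
    intro t ht
    rw [Set.uIcc_of_le h0] at ht
    exact one_sub_mul_tanh_half_sq_pos hH ht.1 (ht.2.trans_lt h1)
  have htanh : Continuous fun t : ℝ => Real.tanh (t / 2) := by
    simp only [Real.tanh_eq_sinh_div_cosh]
    exact (Real.continuous_sinh.comp (by fun_prop)).div (Real.continuous_cosh.comp (by fun_prop))
      fun t => (Real.cosh_pos _).ne'
  rw [intervalIntegral.integral_congr
    (g := fun t => 2 * H * Real.tanh (t / 2) / √(1 - 4 * H ^ 2 * Real.tanh (t / 2) ^ 2))
    fun t ht => slope_eq_tanh_half (by rw [Set.uIcc_of_le h0] at ht; exact ht.1),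
    intervalIntegral.integral_eq_sub_of_hasDerivAt
      fun t ht => hasDerivAt_neg_mul_arctan hH (hpos t ht)]
  · have h := arctan_inv_sqrt_eq_arcsin (x := 2 * H) (by linarith)
    rw [show (2 * H) ^ 2 - 1 = 4 * H ^ 2 - 1 by ring] at h
    rw [← h]
    simp only [zero_div, Real.tanh_zero]
    ring_nf
  · refine ContinuousOn.intervalIntegrable (ContinuousOn.div ?_ ?_ ?_)
    · exact (htanh.const_mul _).continuousOn
    · exact (continuous_const.sub ((htanh.pow 2).const_mul _)).sqrt.continuousOn
    · exact fun t ht => (Real.sqrt_pos.2 (hpos t ht)).ne'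
end

section
/- Let n ≥ 2 be an integer and let r₁ : ℝ → ℝ be a function such that for every d < 0, r₁(d) > 0 and (n-1)·I_{n-1}(r₁(d)) + d = 0. Then r₁(d)/|d|^(1/n) tends to (n/(n-1))^(1/n) as d tends to 0 from the left. In particular r₁(d) tends to 0 as d tends to 0 from the left. -/
open Filter Topology

theorem Real.sinh_le_mul_cosh {t : ℝ} (ht : 0 ≤ t) : Real.sinh t ≤ t * Real.cosh t := by
  have h := (convex_Icc 0 t).image_sub_le_mul_sub_of_deriv_le (f := Real.sinh)
    Real.continuous_sinh.continuousOn Real.differentiable_sinh.differentiableOn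
    (C := Real.cosh t) (fun x hx => by
      rw [interior_Icc] at hx
      rw [Real.deriv_sinh, Real.cosh_le_cosh, abs_of_pos hx.1, abs_of_nonneg ht]
      exact hx.2.le)
    0 ⟨le_rfl, ht⟩ t ⟨ht, le_rfl⟩ ht
  simpa [mul_comm] using h

theorem pow_div_le_Ifun (m : ℕ) {t : ℝ} (ht : 0 ≤ t) :
    t ^ (m + 1) / ((m : ℝ) + 1) ≤ Ifun m t := by
  have h : ∫ τ in (0 : ℝ)..t, τ ^ m = t ^ (m + 1) / ((m : ℝ) + 1) := by simp [integral_pow]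
  rw [← h]
  refine intervalIntegral.integral_mono_on ht ((continuous_pow m).intervalIntegrable _ _)
    ((Real.continuous_sinh.pow m).intervalIntegrable _ _) fun x hx => ?_
  exact pow_le_pow_left₀ hx.1 (Real.self_le_sinh_iff.2 hx.1) m

theorem Ifun_le_cosh_pow_mul (m : ℕ) {t : ℝ} (ht : 0 ≤ t) :
    Ifun m t ≤ Real.cosh t ^ m * (t ^ (m + 1) / ((m : ℝ) + 1)) := by
  have h : ∫ τ in (0 : ℝ)..t, Real.cosh t ^ m * τ ^ m =
      Real.cosh t ^ m * (t ^ (m + 1) / ((m : ℝ) + 1)) := by simp [integral_pow]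
  rw [← h]
  refine intervalIntegral.integral_mono_on ht
    ((Real.continuous_sinh.pow m).intervalIntegrable _ _)
    ((continuous_const.mul (continuous_pow m)).intervalIntegrable _ _) fun x hx => ?_
  rw [← mul_pow, mul_comm]
  refine pow_le_pow_left₀ (Real.sinh_nonneg_iff.2 hx.1)
    ((Real.sinh_le_mul_cosh hx.1).trans (mul_le_mul_of_nonneg_left ?_ hx.1)) m
  rw [Real.cosh_le_cosh, abs_of_nonneg hx.1, abs_of_nonneg ht]
  exact hx.2

/-- For `n ≥ 2` and `r₁(d) = r_{1,d}` the positive solution of `(n-1)·I_{n-1}(ρ) + d = 0`,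
the ratio `r₁(d)/|d|^(1/n)` tends to `(n/(n-1))^(1/n)` as `d → 0⁻`; in particular
`r₁(d) → 0` as `d → 0⁻`. -/
theorem statement12 (n : ℕ) (hn : 2 ≤ n) (r₁ : ℝ → ℝ)
    (h₁ : ∀ d : ℝ, d < 0 →
      0 < r₁ d ∧ ((n : ℝ) - 1) * Ifun (n - 1) (r₁ d) + d = 0) :
    Filter.Tendsto (fun d : ℝ => r₁ d / |d| ^ ((1 : ℝ) / n))
        (nhdsWithin 0 (Set.Iio 0)) (nhds (((n : ℝ) / ((n : ℝ) - 1)) ^ ((1 : ℝ) / n))) ∧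
    Filter.Tendsto r₁ (nhdsWithin 0 (Set.Iio 0)) (nhds 0) := by
  obtain ⟨m, rfl⟩ : ∃ m, n = m + 1 := ⟨n - 1, by omega⟩
  have hm : (0 : ℝ) < m := by exact_mod_cast (by omega : 0 < m)
  simp only [Nat.cast_add, Nat.cast_one, add_sub_cancel_right, Nat.add_sub_cancel] at h₁ ⊢
  set K : ℝ := ((m : ℝ) + 1) / m with hK
  have hexp : (0 : ℝ) < 1 / ((m : ℝ) + 1) := by positivity
  have hroot : ∀ x : ℝ, 0 ≤ x → (x ^ (m + 1)) ^ (1 / ((m : ℝ) + 1)) = x := fun x hx => by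
    simpa using Real.pow_rpow_inv_natCast hx m.succ_ne_zero
  have hupper : ∀ d < 0, r₁ d ^ (m + 1) ≤ K * |d| := fun d hd => by
    obtain ⟨hr, he⟩ := h₁ d hd
    have h := mul_le_mul_of_nonneg_left (pow_div_le_Ifun m hr.le) hm.le
    rw [abs_of_neg hd, hK, div_mul_eq_mul_div, le_div_iff₀ hm]
    rw [mul_div_assoc', div_le_iff₀ (by positivity)] at h
    nlinarith
  have hlower : ∀ d < 0, K * |d| ≤ Real.cosh (r₁ d) ^ m * r₁ d ^ (m + 1) := fun d hd => by
    obtain ⟨hr, he⟩ := h₁ d hd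
    have h := mul_le_mul_of_nonneg_left (Ifun_le_cosh_pow_mul m hr.le) hm.le
    rw [abs_of_neg hd, hK, div_mul_eq_mul_div, div_le_iff₀ hm]
    rw [mul_div_assoc', mul_div_assoc', le_div_iff₀ (by positivity)] at h
    nlinarith
  have hzero : Tendsto r₁ (𝓝[<] 0) (𝓝 0) := by
    have hlim : Tendsto (fun d : ℝ => (K * |d|) ^ (1 / ((m : ℝ) + 1))) (𝓝[<] 0) (𝓝 0) := by
      have hc : Continuous fun d : ℝ => (K * |d|) ^ (1 / ((m : ℝ) + 1)) :=
        (continuous_const.mul continuous_abs).rpow_const fun _ => Or.inr hexp.le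
      have h := (hc.tendsto 0).mono_left (nhdsWithin_le_nhds (s := Set.Iio 0))
      simpa only [abs_zero, mul_zero, Real.zero_rpow hexp.ne'] using h
    refine tendsto_of_tendsto_of_tendsto_of_le_of_le' tendsto_const_nhds hlim ?_ ?_
    · filter_upwards [self_mem_nhdsWithin] with d hd using (h₁ d hd).1.le
    · filter_upwards [self_mem_nhdsWithin] with d hd
      have hr := (h₁ d hd).1
      rw [← hroot _ hr.le]
      exact Real.rpow_le_rpow (by positivity) (hupper d hd) hexp.le
  refine ⟨?_, hzero⟩
  have hratio : Tendsto (fun d => r₁ d ^ (m + 1) / |d|) (𝓝[<] 0) (𝓝 K) := by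
    have hcosh : Tendsto (fun d => K / Real.cosh (r₁ d) ^ m) (𝓝[<] 0) (𝓝 K) := by
      have h := (tendsto_const_nhds (x := K)).div (((Real.continuous_cosh.tendsto 0).comp hzero).pow m)
        (by simp)
      simpa [Pi.div_def] using h
    refine tendsto_of_tendsto_of_tendsto_of_le_of_le' hcosh tendsto_const_nhds ?_ ?_
    · filter_upwards [self_mem_nhdsWithin] with d hd
      have hc := Real.cosh_pos (r₁ d)
      rw [div_le_div_iff₀ (by positivity) (abs_pos.2 (ne_of_lt hd))]
      linarith [hlower d hd]
    · filter_upwards [self_mem_nhdsWithin] with d hd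
      rw [div_le_iff₀ (abs_pos.2 (ne_of_lt hd))]
      exact hupper d hd
  refine (hratio.rpow_const (Or.inr hexp.le)).congr' ?_
  filter_upwards [self_mem_nhdsWithin] with d hd
  have hr := (h₁ d hd).1.le
  rw [Real.div_rpow (by positivity) (abs_nonneg d), hroot _ hr]
end

section
/- Let n ≥ 2 be an integer and let H ≥ (n-1)/n be a real number. Define λ_{H,0}(ρ) = ∫₀^ρ nH·I_{n-1}(t)/√(sinh(t)^(2n-2) − (nH·I_{n-1}(t))²) dt. Then λ_{H,0}(ρ)/ρ² tends to H/2 as ρ tends to 0 from the right. -/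
/-- The generating curve `λ_{H,0}` of the rotationally invariant CMC `H` hypersurface. -/
noncomputable def lam (n : ℕ) (H ρ : ℝ) : ℝ :=
  ∫ t in (0:ℝ)..ρ,
    (n : ℝ) * H * Ifun (n - 1) t /
      Real.sqrt (Real.sinh t ^ (2 * n - 2) - ((n : ℝ) * H * Ifun (n - 1) t) ^ 2)

open Filter Topology

theorem Ifun_hasDerivAt (m : ℕ) (t : ℝ) : HasDerivAt (Ifun m) (Real.sinh t ^ m) t := by
  have hc : Continuous fun τ : ℝ => Real.sinh τ ^ m := Real.continuous_sinh.pow m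
  exact intervalIntegral.integral_hasDerivAt_right (hc.intervalIntegrable _ _)
    (hc.stronglyMeasurableAtFilter _ _) hc.continuousAt

theorem Ifun_continuous (m : ℕ) : Continuous (Ifun m) :=
  continuous_iff_continuousAt.2 fun t => (Ifun_hasDerivAt m t).continuousAt

theorem tendsto_Ifun_div_sinh_pow (m : ℕ) :
    Tendsto (fun t => Ifun m t / Real.sinh t ^ (m + 1)) (𝓝[>] 0) (𝓝 (1 / ((m : ℝ) + 1))) := by
  have hm : (m : ℝ) + 1 ≠ 0 := by positivity
  refine HasDerivAt.lhopital_zero_nhdsGT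
    (f' := fun t => Real.sinh t ^ m)
    (g' := fun t => ((m : ℝ) + 1) * Real.sinh t ^ m * Real.cosh t)
    (Eventually.of_forall fun t => Ifun_hasDerivAt m t)
    (Eventually.of_forall fun t => ?_) ?_ ?_ ?_ ?_
  · simpa using (Real.hasDerivAt_sinh t).fun_pow (m + 1)
  · filter_upwards [self_mem_nhdsWithin] with t ht
    have hs : 0 < Real.sinh t := Real.sinh_pos_iff.2 ht
    have hcosh := Real.cosh_pos t
    positivity
  · have h := (Ifun_continuous m).tendsto 0
    rw [show Ifun m 0 = 0 by simp [Ifun]] at h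
    exact h.mono_left nhdsWithin_le_nhds
  · have h := (Real.continuous_sinh.pow (m + 1)).tendsto 0
    simp only [Pi.pow_apply, Real.sinh_zero, ne_eq, Nat.add_eq_zero_iff, one_ne_zero, and_false,
      not_false_eq_true, zero_pow] at h
    exact h.mono_left nhdsWithin_le_nhds
  · have hcont : Continuous fun t : ℝ => 1 / (((m : ℝ) + 1) * Real.cosh t) :=
      continuous_const.div (by fun_prop) fun t => mul_ne_zero hm (Real.cosh_pos t).ne'
    have h := hcont.tendsto 0
    simp only [Real.cosh_zero, mul_one] at h
    refine (h.mono_left nhdsWithin_le_nhds).congr' ?_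
    filter_upwards [self_mem_nhdsWithin] with t ht
    have hs : Real.sinh t ≠ 0 := (Real.sinh_pos_iff.2 ht).ne'
    have hcosh := (Real.cosh_pos t).ne'
    field_simp

theorem tendsto_sinh_div_self :
    Tendsto (fun t : ℝ => Real.sinh t / t) (𝓝[>] 0) (𝓝 1) := by
  have h := (Real.hasDerivAt_sinh 0).tendsto_slope_zero_right
  simp only [zero_add, Real.sinh_zero, sub_zero, Real.cosh_zero, smul_eq_mul] at h
  exact h.congr fun t => by rw [div_eq_inv_mul]

/-- If `f(t)/t → H` as `t → 0⁺`, then `ρ⁻² ∫₀^ρ f → H/2`. -/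
theorem tendsto_integral_div_sq {f : ℝ → ℝ} (hf : Measurable f) {H : ℝ}
    (h : Tendsto (fun t => f t / t) (𝓝[>] 0) (𝓝 H)) :
    Tendsto (fun ρ => (∫ t in (0 : ℝ)..ρ, f t) / ρ ^ 2) (𝓝[>] 0) (𝓝 (H / 2)) := by
  rw [Metric.tendsto_nhds] at h ⊢
  intro ε hε
  obtain ⟨δ, hδ, hδ'⟩ := mem_nhdsGT_iff_exists_Ioo_subset.1 (h (ε / 2) (half_pos hε))
  filter_upwards [Ioo_mem_nhdsGT hδ] with ρ hρ
  have hρ0 : 0 < ρ := hρ.1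
  have key : ∀ t ∈ Set.uIoc 0 ρ, ‖f t - H * t‖ ≤ ε / 2 * ρ := by
    intro t ht
    rw [Set.uIoc_of_le hρ0.le] at ht
    have h1 : dist (f t / t) H < ε / 2 := hδ' ⟨ht.1, ht.2.trans_lt hρ.2⟩
    have ht0 : 0 < t := ht.1
    have h2 : f t - H * t = (f t / t - H) * t := by field_simp
    rw [h2, norm_mul, Real.norm_of_nonneg ht0.le]
    exact mul_le_mul h1.le ht.2 ht0.le (half_pos hε).le
  have hlin : IntervalIntegrable (fun t : ℝ => H * t) MeasureTheory.volume 0 ρ :=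
    (continuous_const.mul continuous_id).intervalIntegrable _ _
  have hdiff : IntervalIntegrable (fun t => f t - H * t) MeasureTheory.volume 0 ρ := by
    refine (intervalIntegrable_const (c := ε / 2 * ρ)).mono_fun
      (hf.sub (measurable_const.mul measurable_id)).aestronglyMeasurable ?_
    filter_upwards [MeasureTheory.ae_restrict_mem measurableSet_uIoc] with t ht
    exact (key t ht).trans (le_abs_self _)
  have hsplit : (∫ t in (0 : ℝ)..ρ, f t)
      = (∫ t in (0 : ℝ)..ρ, (f t - H * t)) + H * (ρ ^ 2 / 2) := by
    have hlinint : (∫ t in (0 : ℝ)..ρ, H * t) = H * (ρ ^ 2 / 2) := by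
      rw [intervalIntegral.integral_const_mul, integral_id]
      ring
    rw [← hlinint, ← intervalIntegral.integral_add hdiff hlin]
    simp
  have hbound := intervalIntegral.norm_integral_le_of_norm_le_const key
  rw [sub_zero, abs_of_pos hρ0] at hbound
  have hρ2 : 0 < ρ ^ 2 := by positivity
  rw [hsplit, Real.dist_eq]
  have heq : ((∫ t in (0 : ℝ)..ρ, (f t - H * t)) + H * (ρ ^ 2 / 2)) / ρ ^ 2 - H / 2
      = (∫ t in (0 : ℝ)..ρ, (f t - H * t)) / ρ ^ 2 := by
    field_simp
    ring
  rw [heq, abs_div, abs_of_pos hρ2, div_lt_iff₀ hρ2]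
  rw [Real.norm_eq_abs] at hbound
  nlinarith

theorem tendsto_integrand_div_self (m : ℕ) (H : ℝ) :
    Tendsto (fun t => ((m : ℝ) + 1) * H * Ifun m t /
      Real.sqrt (Real.sinh t ^ (2 * m) - (((m : ℝ) + 1) * H * Ifun m t) ^ 2) / t)
      (𝓝[>] 0) (𝓝 H) := by
  have hm : (m : ℝ) + 1 ≠ 0 := by positivity
  have hI := (tendsto_Ifun_div_sinh_pow m).const_mul (((m : ℝ) + 1) * H)
  have hsinh : Tendsto Real.sinh (𝓝[>] 0) (𝓝 0) := by
    simpa using (Real.continuous_sinh.tendsto 0).mono_left nhdsWithin_le_nhds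
  have hsqrt := (((hI.mul hsinh).pow 2).const_sub 1).sqrt
  have h := (hI.mul tendsto_sinh_div_self).div hsqrt (by simp)
  have hval : ((m : ℝ) + 1) * H * (1 / ((m : ℝ) + 1)) * 1 /
      Real.sqrt (1 - (((m : ℝ) + 1) * H * (1 / ((m : ℝ) + 1)) * 0) ^ 2) = H := by
    simp [field]
  rw [hval] at h
  refine h.congr' ?_
  filter_upwards [self_mem_nhdsWithin] with t ht
  have ht0 : 0 < t := ht
  have hs : 0 < Real.sinh t := Real.sinh_pos_iff.2 ht
  have hfac : Real.sinh t ^ (2 * m) - (((m : ℝ) + 1) * H * Ifun m t) ^ 2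
      = (Real.sinh t ^ m) ^ 2 *
        (1 - (((m : ℝ) + 1) * H * (Ifun m t / Real.sinh t ^ (m + 1)) * Real.sinh t) ^ 2) := by
    field_simp
    ring
  rw [hfac, Real.sqrt_mul (by positivity), Real.sqrt_sq (by positivity)]
  simp only [Pi.div_apply, div_eq_mul_inv, mul_inv, pow_succ]
  field_simp

/-- For `n ≥ 2` and `H ≥ (n-1)/n`, `λ_{H,0}(ρ)/ρ² → H/2` as `ρ → 0⁺`. -/
theorem statement15 (n : ℕ) (hn : 2 ≤ n) (H : ℝ) (hH : H ≥ ((n : ℝ) - 1) / n) :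
    Filter.Tendsto (fun ρ : ℝ => lam n H ρ / ρ ^ 2)
      (nhdsWithin 0 (Set.Ioi 0)) (nhds (H / 2)) := by
  obtain ⟨m, rfl⟩ : ∃ m, n = m + 1 := ⟨n - 1, by omega⟩
  have hI : Measurable (Ifun m) := (Ifun_continuous m).measurable
  have hsinh : Measurable Real.sinh := Real.measurable_sinh
  have h := tendsto_integral_div_sq (by fun_prop) (tendsto_integrand_div_self m H)
  simpa [lam, show 2 * (m + 1) - 2 = 2 * m by omega] using h
end
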